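/- Let d_e ≤ d be positive integers and let z ∈ ℝ^{d_e} be a fixed nonzero vector. For a d_e×d matrix B define y₂(B) = Bᵀ (B Bᵀ)⁻¹ z (defined for the almost-every B for which B Bᵀ is invertible, with an arbitrary value otherwise); this is the minimal Euclidean-norm solution of B y = z. Then the pushforward, under the map B ↦ ‖z‖₂² / ‖y₂(B)‖₂², of the Gaussian matrix measure on d_e×d matrices equals the chi-squared distribution with d − d_e + 1 degrees of freedom. -/

import Mathlib

open MeasureTheory ProbabilityTheory Matrix

noncomputable def gaussMatrix (D d : ℕ) : Measure (Fin D → Fin d → ℝ) :=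
  Measure.pi fun _ : Fin D => Measure.pi fun _ : Fin d => gaussianReal 0 1

noncomputable def chiSq (n : ℕ) : Measure ℝ := gammaMeasure (n / 2) (1 / 2)

theorem Measure.map_eq_of_mgf_eq {Ω Ω' : Type*} [MeasurableSpace Ω] [MeasurableSpace Ω']
    {μ : Measure Ω} {ν : Measure Ω'} [IsProbabilityMeasure μ] [IsProbabilityMeasure ν]
    {X : Ω → ℝ} {Y : Ω' → ℝ} (hX : Measurable X) (hY : Measurable Y)
    (h : mgf X μ = mgf Y ν) (h0 : 0 ∈ interior (integrableExpSet X μ)) :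
    μ.map X = ν.map Y := by
  have := Measure.isProbabilityMeasure_map (μ := μ) hX.aemeasurable
  have := Measure.isProbabilityMeasure_map (μ := ν) hY.aemeasurable
  refine Measure.ext_of_charFun (funext fun t => ?_)
  rw [← complexMGF_mul_I hX.aemeasurable, ← complexMGF_mul_I hY.aemeasurable]
  exact eqOn_complexMGF_of_mgf h (by simpa using h0)

theorem integral_gammaMeasure {a r : ℝ} (f : ℝ → ℝ) (ha : 0 < a) (hr : 0 < r) :
    ∫ x, f x ∂gammaMeasure a r
      = ∫ x in Set.Ioi 0, r ^ a / Real.Gamma a * (x ^ (a - 1) * Real.exp (-(r * x))) * f x := by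
  rw [gammaMeasure, integral_withDensity_eq_integral_toReal_smul
    (by unfold gammaPDF; fun_prop) (by simp [gammaPDF]), ← integral_Ici_eq_integral_Ioi,
    ← integral_indicator measurableSet_Ici]
  congr 1 with x
  rw [gammaPDF, ENNReal.toReal_ofReal (gammaPDFReal_nonneg ha hr x)]
  by_cases hx : 0 ≤ x <;> simp [gammaPDFReal, hx, mul_assoc]

theorem mgf_gammaMeasure_of_lt {a r t : ℝ} (ha : 0 < a) (hr : 0 < r) (ht : t < r) :
    mgf id (gammaMeasure a r) t = (r / (r - t)) ^ a := by
  rw [mgf, integral_gammaMeasure _ ha hr]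
  have (x : ℝ) : r ^ a / Real.Gamma a * (x ^ (a - 1) * Real.exp (-(r * x))) * Real.exp (t * id x)
      = r ^ a / Real.Gamma a * (x ^ (a - 1) * Real.exp (-((r - t) * x))) := by
    rw [mul_assoc, mul_assoc, ← Real.exp_add]
    congr 3
    simp only [id]
    ring
  have hG := (Real.Gamma_pos_of_pos ha).ne'
  simp_rw [this, integral_const_mul]
  rw [Real.integral_rpow_mul_exp_neg_mul_Ioi ha (by linarith), div_eq_mul_one_div r,
    Real.mul_rpow hr.le (by rw [one_div]; exact inv_nonneg.2 (by linarith))]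
  field_simp

theorem mgf_gammaMeasure_of_le {a r t : ℝ} (ha : 0 < a) (hr : 0 < r) (ht : r ≤ t) :
    mgf id (gammaMeasure a r) t = 0 := by
  rw [mgf, integral_gammaMeasure _ ha hr]
  have (x : ℝ) : r ^ a / Real.Gamma a * (x ^ (a - 1) * Real.exp (-(r * x))) * Real.exp (t * id x)
      = r ^ a / Real.Gamma a * (x ^ (a - 1) * Real.exp ((t - r) * x)) := by
    rw [mul_assoc, mul_assoc, ← Real.exp_add]
    congr 3
    simp only [id]
    ring
  simp_rw [this, integral_const_mul]
  rw [integral_undef, mul_zero]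
  intro hI
  refine not_integrableOn_Ioi_rpow (a - 1) (Integrable.mono' hI (by fun_prop) ?_)
  filter_upwards [ae_restrict_mem measurableSet_Ioi] with x (hx : 0 < x)
  rw [Real.norm_of_nonneg (by positivity)]
  exact le_mul_of_one_le_right (by positivity)
    (Real.one_le_exp (mul_nonneg (by linarith) hx.le))

theorem mgf_sq_gaussianReal (t : ℝ) :
    mgf (fun x => x ^ 2) (gaussianReal 0 1) t = √(1 / (1 - 2 * t)) := by
  rw [mgf, integral_gaussianReal_eq_integral_smul one_ne_zero]
  have (x : ℝ) : gaussianPDFReal 0 1 x • Real.exp (t * x ^ 2)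
      = (√(2 * Real.pi))⁻¹ * Real.exp (-(1 / 2 - t) * x ^ 2) := by
    simp only [gaussianPDFReal, smul_eq_mul, NNReal.coe_one, mul_one, sub_zero]
    rw [mul_assoc, ← Real.exp_add]
    ring_nf
  simp_rw [this, integral_const_mul]
  rw [integral_gaussian, ← Real.sqrt_inv, ← Real.sqrt_mul (by positivity)]
  congr 1
  rw [show 1 - 2 * t = 2 * (1 / 2 - t) by ring]
  field_simp

theorem mgf_sum_sq_pi_gaussianReal (k : ℕ) (t : ℝ) :
    mgf (fun x : Fin k → ℝ => ∑ i, x i ^ 2) (Measure.pi fun _ => gaussianReal 0 1) t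
      = √(1 / (1 - 2 * t)) ^ k := by
  rw [← mgf_sq_gaussianReal, mgf, mgf]
  simp_rw [Finset.mul_sum, Real.exp_sum]
  rw [integral_fintype_prod_eq_pow (fun x : ℝ => Real.exp (t * x ^ 2)), Fintype.card_fin]

theorem mgf_chiSq {k : ℕ} (hk : 0 < k) (t : ℝ) :
    mgf id (chiSq k) t = √(1 / (1 - 2 * t)) ^ k := by
  have hk' : (0 : ℝ) < k / 2 := by positivity
  rcases lt_or_ge t (1 / 2) with ht | ht
  · rw [chiSq, mgf_gammaMeasure_of_lt hk' (by norm_num) ht,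
      show (1 / 2 : ℝ) / (1 / 2 - t) = 1 / (1 - 2 * t) by
        rw [show 1 - 2 * t = 2 * (1 / 2 - t) by ring]; field_simp,
      Real.sqrt_eq_rpow, ← Real.rpow_natCast, ← Real.rpow_mul]
    · congr 1; ring
    · exact one_div_nonneg.2 (by linarith)
  · rw [chiSq, mgf_gammaMeasure_of_le hk' (by norm_num) ht, Real.sqrt_eq_zero_of_nonpos,
      zero_pow hk.ne']
    exact one_div_nonpos.2 (by linarith)

theorem isProbabilityMeasure_chiSq {k : ℕ} (hk : 0 < k) : IsProbabilityMeasure (chiSq k) :=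
  isProbabilityMeasure_gammaMeasure (by positivity) (by norm_num)

theorem map_sum_sq_pi_gaussianReal {k : ℕ} (hk : 0 < k) :
    (Measure.pi fun _ : Fin k => gaussianReal 0 1).map (fun x => ∑ i, x i ^ 2) = chiSq k := by
  have := isProbabilityMeasure_chiSq hk
  rw [← Measure.map_id (μ := chiSq k)]
  symm
  refine Measure.map_eq_of_mgf_eq measurable_id (by fun_prop)
    (funext fun t => by rw [mgf_chiSq hk, mgf_sum_sq_pi_gaussianReal]) ?_
  refine mem_interior.2 ⟨Set.Iio (1 / 2), fun t (ht : t < 1 / 2) => ?_, isOpen_Iio, by simp⟩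
  by_contra hI
  have h := mgf_chiSq hk t
  rw [mgf, integral_undef hI] at h
  have : 0 < 1 / (1 - 2 * t) := one_div_pos.2 (by linarith)
  have : 0 < √(1 / (1 - 2 * t)) ^ k := by positivity
  linarith

section StdGaussian

variable {E : Type*} [NormedAddCommGroup E] [InnerProductSpace ℝ E] [FiniteDimensional ℝ E]
  [MeasurableSpace E] [BorelSpace E]

theorem map_norm_sq_stdGaussian (h : 0 < Module.finrank ℝ E) :
    (stdGaussian E).map (fun x => ‖x‖ ^ 2) = chiSq (Module.finrank ℝ E) := by
  rw [stdGaussian, Measure.map_map (by fun_prop) (by fun_prop), ← map_sum_sq_pi_gaussianReal h]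
  congr 1 with x
  have := (stdOrthonormalBasis ℝ E).orthonormal.inner_sum x x Finset.univ
  simpa [← real_inner_self_eq_norm_sq, pow_two] using this

theorem map_orthogonalProjection_stdGaussian (W : Submodule ℝ E) :
    (stdGaussian E).map W.orthogonalProjectionOnto = stdGaussian W := by
  have := Measure.isProbabilityMeasure_map (μ := stdGaussian E)
    (f := W.orthogonalProjectionOnto) (by fun_prop)
  refine Measure.ext_of_charFun (funext fun t => ?_)
  rw [charFun_stdGaussian, charFun_apply, integral_map (by fun_prop) (by fun_prop)]
  have := charFun_stdGaussian (t : E)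
  rw [charFun_apply] at this
  simpa using this

theorem map_norm_sq_orthogonalProjection_stdGaussian (W : Submodule ℝ E)
    (h : 0 < Module.finrank ℝ W) :
    (stdGaussian E).map (fun x => ‖W.orthogonalProjectionOnto x‖ ^ 2)
      = chiSq (Module.finrank ℝ W) := by
  rw [← map_norm_sq_stdGaussian h, ← map_orthogonalProjection_stdGaussian,
    Measure.map_map (by fun_prop) (by fun_prop)]
  rfl

theorem ae_stdGaussian_notMem {V : Submodule ℝ E} (hV : V ≠ ⊤) :
    ∀ᵐ x ∂stdGaussian E, x ∉ V := by
  have h : 0 < Module.finrank ℝ Vᗮ := by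
    rw [Module.finrank_pos_iff, Submodule.nontrivial_iff_ne_bot]
    simpa using hV
  have h1 : ∀ᵐ y ∂chiSq (Module.finrank ℝ Vᗮ), y ≠ 0 :=
    (withDensity_absolutelyContinuous _ _).ae_le (Measure.ae_ne volume 0)
  rw [← map_norm_sq_orthogonalProjection_stdGaussian _ h] at h1
  filter_upwards [ae_of_ae_map (by fun_prop) h1] with x hx hxV
  apply hx
  rw [Submodule.orthogonalProjectionOnto_eq_zero_iff.2 (by simpa using hxV)]
  simp

end StdGaussian

/-- The ratio `‖z‖² / ‖Bᵀ (B Bᵀ)⁻¹ z‖²` between a vector and the minimal norm solution of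
`B y = z`. -/
noncomputable def minNormRatio {m d : ℕ} (z : Fin m → ℝ) (B : Fin m → Fin d → ℝ) : ℝ :=
  (∑ i, z i ^ 2) / ∑ i, (((of B)ᵀ * (of B * (of B)ᵀ)⁻¹) *ᵥ z) i ^ 2

theorem measurable_minNormRatio {m d : ℕ} (z : Fin m → ℝ) :
    Measurable (minNormRatio z : (Fin m → Fin d → ℝ) → ℝ) := by
  have hdet : Continuous fun B : Fin m → Fin d → ℝ => (of B * (of B)ᵀ).det := by
    have : Continuous fun B : Fin m → Fin d → ℝ => of B := continuous_id
    fun_prop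
  have hadj (i j : Fin m) :
      Continuous fun B : Fin m → Fin d → ℝ => (of B * (of B)ᵀ).adjugate i j := by
    have : Continuous fun B : Fin m → Fin d → ℝ => of B := continuous_id
    have : Continuous fun B : Fin m → Fin d → ℝ => (of B * (of B)ᵀ).adjugate := by fun_prop
    exact this.matrix_elem i j
  have hinv (i j : Fin m) :
      Measurable fun B : Fin m → Fin d → ℝ => (of B * (of B)ᵀ)⁻¹ i j := by
    simp only [Matrix.inv_def, Ring.inverse_eq_inv', Matrix.smul_apply, smul_eq_mul]
    exact hdet.measurable.inv.mul (hadj i j).measurable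
  unfold minNormRatio
  refine measurable_const.div (Finset.measurable_sum _ fun i _ => Measurable.pow_const ?_ 2)
  simp only [Matrix.mulVec, dotProduct, Matrix.mul_apply, Matrix.transpose_apply, of_apply]
  refine Finset.measurable_sum _ fun j _ => Measurable.mul_const ?_ _
  refine Finset.measurable_sum _ fun k _ => Measurable.mul (by fun_prop) ?_
  exact hinv k j

theorem isUnit_mul_transpose_of_linearIndependent {m d : ℕ} {B : Fin m → Fin d → ℝ}
    (hB : LinearIndependent ℝ B) : IsUnit (of B * (of B)ᵀ) := by
  rw [← Matrix.mulVec_injective_iff_isUnit]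
  have h : Function.Injective fun v => v ᵥ* of B := Matrix.vecMul_injective_iff.2 hB
  refine (injective_iff_map_eq_zero (Matrix.mulVecLin (of B * (of B)ᵀ))).2 fun v hv => ?_
  rw [Matrix.mulVecLin_apply, ← Matrix.conjTranspose_eq_transpose_of_trivial,
    Matrix.self_mul_conjTranspose_mulVec_eq_zero,
    Matrix.conjTranspose_eq_transpose_of_trivial, Matrix.mulVec_transpose] at hv
  exact h (by simpa using hv)

theorem sq_div_norm_sq_eq {E : Type*} [NormedAddCommGroup E] [InnerProductSpace ℝ E]
    [FiniteDimensional ℝ E] (V : Submodule ℝ E) {x y r : E} {a c : ℝ} (hc : c ≠ 0)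
    (hr : r ∈ V) (hy : y = a • x + r) (hyV : y ∈ Vᗮ) (hxy : inner ℝ x y = c) :
    c ^ 2 / ‖y‖ ^ 2 = ‖Vᗮ.orthogonalProjectionOnto x‖ ^ 2 := by
  have h1 : y = a • (Vᗮ.orthogonalProjectionOnto x : E) := by
    have h2 := congrArg (fun v => (Vᗮ.orthogonalProjectionOnto v : E)) hy
    simp only [map_add, map_smul, Submodule.coe_add, Submodule.coe_smul] at h2
    have hPy : (Vᗮ.orthogonalProjectionOnto y : E) = y :=
      Submodule.starProjection_eq_self_iff.2 hyV
    rw [hPy,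
      Submodule.orthogonalProjectionOnto_eq_zero_iff.2
        (V.le_orthogonal_orthogonal hr : r ∈ Vᗮᗮ)] at h2
    simpa using h2
  have h3 : inner ℝ x (Vᗮ.orthogonalProjectionOnto x : E)
      = ‖Vᗮ.orthogonalProjectionOnto x‖ ^ 2 := by
    rw [← Submodule.inner_orthogonalProjectionOnto_eq_of_mem_right,
      real_inner_self_eq_norm_sq]
  set p := ‖Vᗮ.orthogonalProjectionOnto x‖ with hp
  have h4 : a * p ^ 2 = c := by rw [← hxy, h1, inner_smul_right, h3]
  have h5 : ‖y‖ ^ 2 = a ^ 2 * p ^ 2 := by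
    rw [h1, norm_smul, mul_pow, Real.norm_eq_abs, sq_abs, ← Submodule.coe_norm]
  have ha : a ≠ 0 := by rintro rfl; simp at h4; exact hc h4.symm
  have hp0 : p ≠ 0 := by rintro h; simp [h] at h4; exact hc h4.symm
  rw [h5, ← h4]
  field_simp

/-- The span of the rows `R`, as a subspace of Euclidean space. -/
noncomputable def rowSpan {m d : ℕ} (R : Fin m → Fin d → ℝ) :
    Submodule ℝ (EuclideanSpace ℝ (Fin d)) :=
  (Submodule.span ℝ (Set.range R)).map (WithLp.linearEquiv 2 ℝ (Fin d → ℝ)).symm.toLinearMap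

theorem toLp_mem_rowSpan {m d : ℕ} {R : Fin m → Fin d → ℝ} {x : Fin d → ℝ} :
    WithLp.toLp 2 x ∈ rowSpan R ↔ x ∈ Submodule.span ℝ (Set.range R) := by
  constructor
  · rintro ⟨y, hy, h⟩
    have : y = x := WithLp.toLp_injective 2 h
    exact this ▸ hy
  · exact fun h => ⟨x, h, rfl⟩

theorem finrank_rowSpan {m d : ℕ} {R : Fin m → Fin d → ℝ} (hR : LinearIndependent ℝ R) :
    Module.finrank ℝ (rowSpan R) = m := by
  rw [rowSpan, LinearEquiv.finrank_map_eq, finrank_span_eq_card hR, Fintype.card_fin]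

theorem ae_notMem_span {m d : ℕ} (hmd : m < d) {R : Fin m → Fin d → ℝ}
    (hR : LinearIndependent ℝ R) :
    ∀ᵐ x ∂(Measure.pi fun _ : Fin d => gaussianReal 0 1),
      x ∉ Submodule.span ℝ (Set.range R) := by
  have hV : rowSpan R ≠ ⊤ := fun h => by
    have := finrank_rowSpan hR
    rw [h, finrank_top, finrank_euclideanSpace_fin] at this
    omega
  have h := ae_stdGaussian_notMem hV
  rw [← map_pi_eq_stdGaussian] at h
  filter_upwards [ae_of_ae_map (by fun_prop) h] with x hx
  rwa [toLp_mem_rowSpan] at hx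

instance (m d : ℕ) : IsProbabilityMeasure (gaussMatrix m d) := by
  unfold gaussMatrix; infer_instance

theorem measurePreserving_finCons_gaussMatrix (m d : ℕ) :
    MeasurePreserving (fun p : (Fin d → ℝ) × (Fin m → Fin d → ℝ) =>
        (Fin.cons p.1 p.2 : Fin (m + 1) → Fin d → ℝ))
      ((Measure.pi fun _ : Fin d => gaussianReal 0 1).prod (gaussMatrix m d))
      (gaussMatrix (m + 1) d) := by
  have := (measurePreserving_piFinSuccAbove (fun _ : Fin (m + 1) =>
    Measure.pi fun _ : Fin d => gaussianReal 0 1) 0).symm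
  convert! this using 1
  ext p : 1
  simp [MeasurableEquiv.piFinSuccAbove_symm_apply, Fin.insertNthEquiv]

theorem ae_linearIndependent_gaussMatrix {m d : ℕ} (hmd : m ≤ d) :
    ∀ᵐ B ∂gaussMatrix m d, LinearIndependent ℝ B := by
  induction m with
  | zero => exact ae_of_all _ fun B => linearIndependent_empty_type
  | succ m ih =>
    have hmp := measurePreserving_finCons_gaussMatrix m d
    have hmeas : MeasurableSet {B : Fin (m + 1) → Fin d → ℝ | LinearIndependent ℝ B} :=
      isOpen_setOfPred_linearIndependent.measurableSet
    rw [← hmp.map_eq, ae_map_iff hmp.aemeasurable hmeas]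
    refine (Measure.ae_prod_iff_ae_ae (hmp.measurable hmeas)).2 ((Measure.ae_ae_comm
      (p := fun x R => LinearIndependent ℝ (Fin.cons x R : Fin (m + 1) → Fin d → ℝ))
      (hmp.measurable hmeas)).2 ?_)
    filter_upwards [ih (by omega)] with R hR
    filter_upwards [ae_notMem_span (by omega) hR] with x hx
    exact hR.finCons hx

theorem minNormRatio_single_finCons {m d : ℕ} {c : ℝ} (hc : c ≠ 0) {R : Fin m → Fin d → ℝ}
    {x : Fin d → ℝ} (h : LinearIndependent ℝ (Fin.cons x R : Fin (m + 1) → Fin d → ℝ)) :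
    minNormRatio (Pi.single 0 c) (Fin.cons x R : Fin (m + 1) → Fin d → ℝ)
      = ‖(rowSpan R)ᗮ.orthogonalProjectionOnto (WithLp.toLp 2 x)‖ ^ 2 := by
  set B : Fin (m + 1) → Fin d → ℝ := Fin.cons x R with hB
  have hu := isUnit_mul_transpose_of_linearIndependent h
  set w := (of B * (of B)ᵀ)⁻¹ *ᵥ Pi.single 0 c with hw
  set y := (of B)ᵀ *ᵥ w with hy
  have hBy : of B *ᵥ y = Pi.single 0 c := by
    rw [hy, hw, Matrix.mulVec_mulVec, Matrix.mulVec_mulVec,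
      Matrix.mul_nonsing_inv _ ((Matrix.isUnit_iff_isUnit_det _).1 hu), Matrix.one_mulVec]
  have hx0 : x ⬝ᵥ y = c := by simpa [Matrix.mulVec, hB] using congrFun hBy 0
  have hR0 (i : Fin m) : R i ⬝ᵥ y = 0 := by
    simpa [Matrix.mulVec, hB] using congrFun hBy i.succ
  have hsum : y = w 0 • x + ∑ i : Fin m, w i.succ • R i := by
    rw [hy, Matrix.mulVec_transpose, Matrix.vecMul_eq_sum, Fin.sum_univ_succ]
    rfl
  rw [← sq_div_norm_sq_eq (rowSpan R) hc (x := WithLp.toLp 2 x) (y := WithLp.toLp 2 y)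
    (r := WithLp.toLp 2 (∑ i : Fin m, w i.succ • R i)) (a := w 0)]
  · rw [minNormRatio, ← Matrix.mulVec_mulVec, ← hw, ← hy, EuclideanSpace.real_norm_sq_eq]
    congr 1
    rw [Finset.sum_eq_single 0] <;> simp +contextual
  · rw [toLp_mem_rowSpan]
    exact Submodule.sum_mem _ fun i _ =>
      Submodule.smul_mem _ _ (Submodule.subset_span ⟨i, rfl⟩)
  · rw [← WithLp.toLp_smul, ← WithLp.toLp_add, ← hsum]
  · rw [Submodule.mem_orthogonal]
    rintro _ ⟨u, hu, rfl⟩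
    have : u ⬝ᵥ y = 0 := by
      induction hu using Submodule.span_induction with
      | mem u hu => obtain ⟨i, rfl⟩ := hu; exact hR0 i
      | zero => simp
      | add u v _ _ hu hv => rw [add_dotProduct, hu, hv, add_zero]
      | smul a u _ hu => rw [smul_dotProduct, hu, smul_zero]
    simpa [EuclideanSpace.inner_eq_star_dotProduct, dotProduct_comm] using this
  · simpa [EuclideanSpace.inner_eq_star_dotProduct, dotProduct_comm] using hx0

theorem map_minNormRatio_finCons {m d : ℕ} (hmd : m < d) {c : ℝ} (hc : c ≠ 0)
    {R : Fin m → Fin d → ℝ} (hR : LinearIndependent ℝ R) :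
    (Measure.pi fun _ : Fin d => gaussianReal 0 1).map
        (fun x => minNormRatio (Pi.single 0 c) (Fin.cons x R : Fin (m + 1) → Fin d → ℝ))
      = chiSq (d - m) := by
  have hfr : Module.finrank ℝ (rowSpan R)ᗮ = d - m := by
    have := (rowSpan R).finrank_add_finrank_orthogonal
    rw [finrank_rowSpan hR, finrank_euclideanSpace_fin] at this
    omega
  rw [← hfr, ← map_norm_sq_orthogonalProjection_stdGaussian _ (by omega),
    ← map_pi_eq_stdGaussian, Measure.map_map (by fun_prop) (by fun_prop)]
  refine Measure.map_congr ?_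
  filter_upwards [ae_notMem_span hmd hR] with x hx
  exact minNormRatio_single_finCons hc (hR.finCons hx)

theorem map_minNormRatio_single {m d : ℕ} (hmd : m < d) {c : ℝ} (hc : c ≠ 0) :
    (gaussMatrix (m + 1) d).map (minNormRatio (Pi.single 0 c)) = chiSq (d - m) := by
  have hmp := measurePreserving_finCons_gaussMatrix m d
  have hmeas := measurable_minNormRatio (d := d) (Pi.single 0 c : Fin (m + 1) → ℝ)
  rw [← hmp.map_eq, Measure.map_map hmeas hmp.measurable]
  ext s hs
  rw [Measure.map_apply (hmeas.comp hmp.measurable) hs,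
    Measure.prod_apply_symm (hmeas.comp hmp.measurable hs)]
  trans ∫⁻ _, chiSq (d - m) s ∂gaussMatrix m d
  · refine lintegral_congr_ae ?_
    filter_upwards [ae_linearIndependent_gaussMatrix hmd.le] with R hR
    have hx : Measurable fun x : Fin d → ℝ => (x, R) := by fun_prop
    have hRmeas : Measurable fun x : Fin d → ℝ =>
        minNormRatio (Pi.single 0 c) (Fin.cons x R : Fin (m + 1) → Fin d → ℝ) :=
      hmeas.comp (hmp.measurable.comp hx)
    rw [← map_minNormRatio_finCons hmd hc hR, Measure.map_apply hRmeas hs]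
    rfl
  · simp

theorem mulVec_dotProduct_mulVec_of_orthogonal {m : ℕ} {U : Matrix (Fin m) (Fin m) ℝ}
    (hU : Uᵀ * U = 1) (z : Fin m → ℝ) : (U *ᵥ z) ⬝ᵥ (U *ᵥ z) = z ⬝ᵥ z := by
  rw [Matrix.dotProduct_mulVec, Matrix.vecMul_mulVec, hU, Matrix.vecMul_one]

theorem measurable_mul_of {m : ℕ} (d : ℕ) (U : Matrix (Fin m) (Fin m) ℝ) :
    Measurable fun B : Fin m → Fin d → ℝ => of.symm (U * of B) := by
  refine measurable_pi_lambda _ fun i => measurable_pi_lambda _ fun j => ?_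
  change Measurable fun B : Fin m → Fin d → ℝ => ∑ k, U i k * B k j
  fun_prop

theorem minNormRatio_mul {m d : ℕ} {U : Matrix (Fin m) (Fin m) ℝ} (hU : Uᵀ * U = 1)
    (z : Fin m → ℝ) (B : Fin m → Fin d → ℝ) :
    minNormRatio (U *ᵥ z) (of.symm (U * of B)) = minNormRatio z B := by
  have hU' : U * Uᵀ = 1 := mul_eq_one_comm.1 hU
  have hinv : U⁻¹ = Uᵀ := Matrix.inv_eq_left_inv hU
  have hinv' : Uᵀ⁻¹ = U := Matrix.inv_eq_left_inv hU'
  unfold minNormRatio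
  congr 1
  · simpa [dotProduct, pow_two] using mulVec_dotProduct_mulVec_of_orthogonal hU z
  · rw [Equiv.apply_symm_apply, Matrix.mulVec_mulVec]
    generalize of B = A
    have h1 : U * A * (U * A)ᵀ = U * (A * Aᵀ * Uᵀ) := by
      simp only [Matrix.transpose_mul, Matrix.mul_assoc]
    have h2 : (U * A)ᵀ * (U * A * (U * A)ᵀ)⁻¹ * U = Aᵀ * (A * Aᵀ)⁻¹ := by
      rw [h1, Matrix.mul_inv_rev, Matrix.mul_inv_rev, hinv, hinv', Matrix.transpose_mul]
      generalize (A * Aᵀ)⁻¹ = C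
      calc Aᵀ * Uᵀ * (U * C * Uᵀ) * U = Aᵀ * (Uᵀ * U) * C * (Uᵀ * U) := by
            simp only [Matrix.mul_assoc]
        _ = Aᵀ * C := by rw [hU, Matrix.mul_one, Matrix.mul_one]
    rw [h2]

theorem exists_orthogonal_mulVec_eq_single {m : ℕ} {z : Fin (m + 1) → ℝ} (hz : z ≠ 0) :
    ∃ (U : Matrix (Fin (m + 1)) (Fin (m + 1)) ℝ) (c : ℝ), c ≠ 0 ∧ Uᵀ * U = 1 ∧
      U *ᵥ z = Pi.single 0 c := by
  set e : EuclideanSpace ℝ (Fin (m + 1)) := WithLp.toLp 2 z with he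
  have he0 : ‖e‖ ≠ 0 := by simpa [he] using hz
  have hv : Orthonormal ℝ (({0} : Set (Fin (m + 1))).domRestrict fun _ => ‖e‖⁻¹ • e) := by
    refine ⟨fun i => by simp [norm_smul, he0], fun i j hij => ?_⟩
    exact (hij (Subsingleton.elim i j)).elim
  obtain ⟨b, hb⟩ := hv.exists_orthonormalBasis_extension_of_card_eq (by simp)
  have hez : e = ‖e‖ • b 0 := by rw [hb 0 rfl, smul_smul, mul_inv_cancel₀ he0, one_smul]
  refine ⟨of fun i j => b i j, ‖e‖, he0, ?_, ?_⟩
  · rw [mul_eq_one_comm]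
    ext i j
    have := orthonormal_iff_ite.1 b.orthonormal j i
    simpa [Matrix.mul_apply, Matrix.one_apply, PiLp.inner_apply, eq_comm] using this
  · ext i
    have h : inner ℝ e (b i) = if i = 0 then ‖e‖ else 0 := by
      rw [hez, inner_smul_left, orthonormal_iff_ite.1 b.orthonormal 0 i]
      simp [norm_smul, eq_comm]
    simpa [Matrix.mulVec, dotProduct, PiLp.inner_apply, Pi.single_apply, he] using h

theorem map_stdGaussian_eq_gaussMatrix (m d : ℕ) :
    (stdGaussian (EuclideanSpace ℝ (Fin m × Fin d))).map (fun x i j => x (i, j))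
      = gaussMatrix m d := by
  have h := Measure.infinitePi_map_curry (fun (_ : Fin m) (_ : Fin d) => gaussianReal 0 1)
  simp only [Measure.infinitePi_eq_pi] at h
  rw [gaussMatrix, ← h, ← map_pi_eq_stdGaussian, Measure.map_map (by fun_prop) (by fun_prop)]
  rfl

theorem gaussMatrix_map_mul {m : ℕ} (d : ℕ) {U : Matrix (Fin m) (Fin m) ℝ} (hU : Uᵀ * U = 1) :
    (gaussMatrix m d).map (fun B => of.symm (U * of B)) = gaussMatrix m d := by
  let L : EuclideanSpace ℝ (Fin m × Fin d) →ₗ[ℝ] EuclideanSpace ℝ (Fin m × Fin d) :=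
    { toFun := fun x => WithLp.toLp 2 fun p => ∑ k, U p.1 k * x (k, p.2)
      map_add' := fun x y => by ext p; simp [mul_add, Finset.sum_add_distrib]
      map_smul' := fun a x => by ext p; simp [Finset.mul_sum, mul_left_comm] }
  have hL (x) : ‖L x‖ = ‖x‖ := by
    rw [← sq_eq_sq₀ (norm_nonneg _) (norm_nonneg _), EuclideanSpace.real_norm_sq_eq,
      EuclideanSpace.real_norm_sq_eq, Fintype.sum_prod_type_right, Fintype.sum_prod_type_right]
    refine Finset.sum_congr rfl fun j _ => ?_
    simpa [dotProduct, Matrix.mulVec, pow_two, L] using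
      mulVec_dotProduct_mulVec_of_orthogonal hU fun i => x (i, j)
  let e := (LinearIsometry.mk L hL).toLinearIsometryEquiv rfl
  have he := stdGaussian_map e
  rw [← map_stdGaussian_eq_gaussMatrix, Measure.map_map]
  · conv_rhs => rw [← he]
    rw [Measure.map_map (by fun_prop) (by fun_prop)]
    rfl
  · exact measurable_mul_of d U
  · fun_prop

theorem stmt12 (de d : ℕ) (hde : 0 < de) (hd : 0 < d) (h : de ≤ d)
    (z : Fin de → ℝ) (hz : z ≠ 0)
    (y2 : (Fin de → Fin d → ℝ) → (Fin d → ℝ))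
    (hy2 : ∀ B : Fin de → Fin d → ℝ,
      IsUnit (Matrix.of B * (Matrix.of B).transpose) →
      y2 B = ((Matrix.of B).transpose *
        (Matrix.of B * (Matrix.of B).transpose)⁻¹).mulVec z) :
    Measure.map (fun B => (∑ i, z i ^ 2) / (∑ i, (y2 B) i ^ 2)) (gaussMatrix de d)
      = chiSq (d - de + 1) := by
  obtain ⟨m, rfl⟩ : ∃ m, de = m + 1 := ⟨de - 1, by omega⟩
  obtain ⟨U, c, hc, hU, hUz⟩ := exists_orthogonal_mulVec_eq_single hz
  trans (gaussMatrix (m + 1) d).map (minNormRatio z)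
  · refine Measure.map_congr ?_
    filter_upwards [ae_linearIndependent_gaussMatrix h] with B hB
    rw [hy2 B (isUnit_mul_transpose_of_linearIndependent hB), minNormRatio]
  · rw [show d - (m + 1) + 1 = d - m by omega, ← map_minNormRatio_single (by omega) hc, ← hUz]
    conv_rhs => rw [← gaussMatrix_map_mul d hU,
      Measure.map_map (measurable_minNormRatio _) (measurable_mul_of d U)]
    congr 1 with B
    exact (minNormRatio_mul hU z B).symm
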